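/- arXiv:2510.22355 — 12 statements merged into one kernel-verified Lean document; each statement's English description precedes it below -/
import Mathlib

section
/- Let L be a complete lattice that is an X-top lattice for a subset X of L not containing ⊤, with X carrying the X-top topology. Then: (1) for every x ∈ X, the closure of {x} equals V(x) = {y ∈ X | x ≤ y}; consequently {x} is closed if and only if x is a maximal element of X; (2) for every x ∈ X, the intersection of all open sets containing x equals {z ∈ X | z ≤ x}; consequently this intersection equals {x} if and only if x is a minimal element of X. -/
/-- The variety of `a` in `X`: the set of elements of `X` lying above `a`. -/
def zarV {L : Type*} [CompleteLattice L] (X : Set L) (a : L) : Set X :=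
  {x : X | a ≤ (x : L)}

/-- `L` is an `X`-top lattice: varieties are closed under (binary, hence finite) unions. -/
def IsXTop {L : Type*} [CompleteLattice L] (X : Set L) : Prop :=
  ∀ a b : L, ∃ c : L, zarV X a ∪ zarV X b = zarV X c

/-- The `X`-top (Zariski-like) topology on `X`, generated by the sets `D(a) = (zarV X a)ᶜ`. -/
def xTopTopology {L : Type*} [CompleteLattice L] (X : Set L) : TopologicalSpace X :=
  TopologicalSpace.generateFrom {U : Set X | ∃ a : L, U = (zarV X a)ᶜ}

theorem xtop_open_lower {L : Type*} [CompleteLattice L] (X : Set L) (U : Set X)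
    (hU : @IsOpen X (xTopTopology X) U) : ∀ y z : X, (z : L) ≤ (y : L) → y ∈ U → z ∈ U := by
  have h : TopologicalSpace.GenerateOpen {U : Set X | ∃ a : L, U = (zarV X a)ᶜ} U := hU
  induction h with
  | basic s hs =>
    obtain ⟨a, rfl⟩ := hs
    intro y z hzy hy hz
    exact hy (le_trans (show a ≤ (z : L) from hz) hzy)
  | univ => intros; trivial
  | inter s t hs ht ihs iht =>
    intro y z hzy hy
    exact ⟨ihs hs y z hzy hy.1, iht ht y z hzy hy.2⟩
  | sUnion S hS ih =>
    rintro y z hzy ⟨s, hs, hy⟩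
    exact ⟨s, hs, ih s hs (hS s hs) y z hzy hy⟩

theorem xtop_basic_open {L : Type*} [CompleteLattice L] (X : Set L) (a : L) :
    @IsOpen X (xTopTopology X) (zarV X a)ᶜ :=
  TopologicalSpace.GenerateOpen.basic _ ⟨a, rfl⟩

theorem xtop_closure_singleton_and_kernel {L : Type*} [CompleteLattice L] (X : Set L)
    (hX : ⊤ ∉ X) (hXtop : IsXTop X) :
    (∀ x : X,
      @closure X (xTopTopology X) {x} = zarV X (x : L) ∧
      (@IsClosed X (xTopTopology X) {x} ↔ ∀ y ∈ X, (x : L) ≤ y → y = (x : L))) ∧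
    (∀ x : X,
      (⋂ U ∈ {U : Set X | @IsOpen X (xTopTopology X) U ∧ x ∈ U}, U) = {z : X | (z : L) ≤ (x : L)} ∧
      ((⋂ U ∈ {U : Set X | @IsOpen X (xTopTopology X) U ∧ x ∈ U}, U) = {x} ↔
        ∀ y ∈ X, y ≤ (x : L) → y = (x : L))) := by
  have hcl : ∀ x : X, @closure X (xTopTopology X) {x} = zarV X (x : L) := by
    intro x
    letI := xTopTopology X
    apply Set.Subset.antisymm
    · apply closure_minimal
      · rintro y rfl
        exact le_refl (y : L)
      · exact ⟨xtop_basic_open X x⟩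
    · intro y hy
      rw [mem_closure_iff]
      intro U hU hyU
      exact ⟨x, xtop_open_lower X U hU y x hy hyU, rfl⟩
  have hker : ∀ x : X, (⋂ U ∈ {U : Set X | @IsOpen X (xTopTopology X) U ∧ x ∈ U}, U)
      = {z : X | (z : L) ≤ (x : L)} := by
    intro x
    ext z
    simp only [Set.mem_iInter, Set.mem_setOf_eq]
    constructor
    · intro h
      by_contra hzx
      exact h _ ⟨xtop_basic_open X (z : L), hzx⟩ (le_refl (z : L))
    · rintro h U ⟨hU, hx⟩
      exact xtop_open_lower X U hU x z h hx
  refine ⟨fun x => ⟨hcl x, ?_⟩, fun x => ⟨hker x, ?_⟩⟩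
  · letI := xTopTopology X
    rw [← closure_eq_iff_isClosed, hcl x]
    constructor
    · intro h y hy hxy
      have h1 : (⟨y, hy⟩ : X) ∈ ({x} : Set X) := h ▸ (show (⟨y, hy⟩ : X) ∈ zarV X x from hxy)
      exact congrArg Subtype.val h1
    · intro h
      ext y
      constructor
      · intro hy
        exact Subtype.ext (h y y.2 hy)
      · rintro rfl
        exact le_refl (y : L)
  · rw [hker x]
    constructor
    · intro h y hy hxy
      have h1 : (⟨y, hy⟩ : X) ∈ ({x} : Set X) :=
        h ▸ (show (⟨y, hy⟩ : X) ∈ {z : X | (z : L) ≤ (x : L)} from hxy)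
      exact congrArg Subtype.val h1
    · intro h
      ext y
      constructor
      · intro hy
        exact Subtype.ext (h y y.2 hy)
      · rintro rfl
        exact le_refl (y : L)
end

section
/- Let L be a complete lattice that is an X-top lattice for a subset X of L not containing ⊤, with X carrying the X-top topology. Then a point x ∈ X is isolated (i.e. {x} is open) if and only if x is a minimal element of X and x is completely strongly X-irreducible, i.e. for every subset A ⊆ X with ⨅ A ≤ x there exists a ∈ A with a ≤ x. In symbols, Iso(X) = Min(X) ∩ CSI^X(X). -/
theorem xtop_open_basic {L : Type*} [CompleteLattice L] (X : Set L)
    (hX : ⊤ ∉ X) (hXtop : IsXTop X) (U : Set X)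
    (hU : @IsOpen X (xTopTopology X) U) : ∃ a : L, U = (zarV X a)ᶜ := by
  change TopologicalSpace.GenerateOpen _ U at hU
  induction hU with
  | basic s hs => exact hs
  | univ =>
    refine ⟨⊤, ?_⟩
    ext y
    simp only [zarV, Set.mem_univ, Set.mem_compl_iff, Set.mem_setOf_eq, true_iff]
    intro h
    exact hX (top_le_iff.mp h ▸ y.2)
  | inter s t _ _ hs ht =>
    obtain ⟨a, rfl⟩ := hs
    obtain ⟨b, rfl⟩ := ht
    obtain ⟨c, hc⟩ := hXtop a b
    exact ⟨c, by rw [← hc, Set.compl_union]⟩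
  | sUnion S _ ih =>
    refine ⟨sSup {a | (zarV X a)ᶜ ∈ S}, ?_⟩
    ext y
    simp only [zarV, Set.mem_sUnion, Set.mem_compl_iff, Set.mem_setOf_eq, sSup_le_iff]
    constructor
    · rintro ⟨t, ht, hy⟩ h
      obtain ⟨a, rfl⟩ := ih t ht
      exact hy (h a ht)
    · intro h
      push Not at h
      obtain ⟨a, ha, hy⟩ := h
      exact ⟨_, ha, hy⟩

theorem xtop_isolated_iff {L : Type*} [CompleteLattice L] (X : Set L)
    (hX : ⊤ ∉ X) (hXtop : IsXTop X) (x : X) :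
    @IsOpen X (xTopTopology X) {x} ↔
      (∀ y ∈ X, y ≤ (x : L) → y = (x : L)) ∧
      (∀ A ⊆ X, sInf A ≤ (x : L) → ∃ a ∈ A, a ≤ (x : L)) := by
  constructor
  · intro h
    obtain ⟨a, ha⟩ := xtop_open_basic X hX hXtop _ h
    have hm : ∀ y : X, y = x ↔ ¬ a ≤ (y : L) := fun y => by
      have := Set.ext_iff.mp ha y
      simpa [zarV] using this
    have hx : ¬ a ≤ (x : L) := (hm x).mp rfl
    refine ⟨fun y hy hyx => ?_, fun A hA hAx => ?_⟩
    · exact congrArg Subtype.val ((hm ⟨y, hy⟩).mpr fun h => hx (h.trans hyx))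
    · by_contra hc
      push Not at hc
      refine hx (le_trans (le_sInf fun b hb => ?_) hAx)
      by_contra hab
      have := congrArg Subtype.val ((hm ⟨b, hA hb⟩).mpr hab)
      exact hc b hb (le_of_eq this)
  · rintro ⟨hmin, hirr⟩
    refine TopologicalSpace.GenerateOpen.basic _ ⟨sInf (X \ {(x : L)}), ?_⟩
    ext y
    simp only [zarV, Set.mem_singleton_iff, Set.mem_compl_iff, Set.mem_setOf_eq]
    constructor
    · rintro rfl h
      obtain ⟨b, hb, hbx⟩ := hirr _ Set.diff_subset h
      exact hb.2 (hmin b hb.1 hbx)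
    · intro h
      by_contra hne
      exact h (sInf_le ⟨y.2, fun h' => hne (Subtype.ext h')⟩)
end

section
/- Let L be a complete lattice that is an X-top lattice for a subset X of L not containing ⊤, with X carrying the X-top topology. Then the following are equivalent: (1) the X-top topology on X is discrete; (2) every x ∈ X is a minimal element of X and is completely strongly X-irreducible; (3) every x ∈ X is minimal in X and the infimum of Min(X) \ {x} is not ≤ x; (4) every x ∈ X is maximal in X and the infimum of Max(X) \ {x} is not ≤ x; (5) X is T₁ and for every maximal element x of X the infimum of Max(X) \ {x} is not ≤ x. -/
/-- The set of minimal elements of `X`. -/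
def minSet {L : Type*} [CompleteLattice L] (X : Set L) : Set L :=
  {x ∈ X | ∀ y ∈ X, y ≤ x → y = x}

/-- The set of maximal elements of `X`. -/
def maxSet {L : Type*} [CompleteLattice L] (X : Set L) : Set L :=
  {x ∈ X | ∀ y ∈ X, x ≤ y → x = y}

theorem xtop_discrete_tfae {L : Type*} [CompleteLattice L] (X : Set L)
    (hX : ⊤ ∉ X) (hXtop : IsXTop X) :
    List.TFAE [
      xTopTopology X = ⊥,
      ∀ x ∈ X, (∀ y ∈ X, y ≤ x → y = x) ∧ (∀ A ⊆ X, sInf A ≤ x → ∃ a ∈ A, a ≤ x),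
      ∀ x ∈ X, x ∈ minSet X ∧ ¬ sInf (minSet X \ {x}) ≤ x,
      ∀ x ∈ X, x ∈ maxSet X ∧ ¬ sInf (maxSet X \ {x}) ≤ x,
      @T1Space X (xTopTopology X) ∧ ∀ x ∈ maxSet X, ¬ sInf (maxSet X \ {x}) ≤ x] := by
  have hmin : ∀ (_ : ∀ x ∈ X, ¬ sInf (X \ {x}) ≤ x), ∀ x ∈ X, ∀ y ∈ X, y ≤ x → y = x := by
    intro hP x hx y hy hyx
    by_contra hne
    exact hP x hx ((sInf_le (show y ∈ X \ {x} from ⟨hy, hne⟩)).trans hyx)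
  have emin : ∀ (_ : ∀ x ∈ X, x ∈ minSet X), minSet X = X := fun h =>
    Set.Subset.antisymm (fun x hx => hx.1) h
  have emax : ∀ (_ : ∀ x ∈ X, x ∈ maxSet X), maxSet X = X := fun h =>
    Set.Subset.antisymm (fun x hx => hx.1) h
  have low : ∀ U : Set X, @IsOpen X (xTopTopology X) U → ∀ x y : X, x ≤ y → y ∈ U → x ∈ U := by
    intro U hU
    induction hU with
    | basic s hs =>
      obtain ⟨a, rfl⟩ := hs
      intro x y hxy hy hx
      exact hy (le_trans (show a ≤ (x : L) from hx) hxy)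
    | univ => intros; trivial
    | inter s t _ _ h1 h2 =>
      intro x y hxy hy
      exact ⟨h1 x y hxy hy.1, h2 x y hxy hy.2⟩
    | sUnion S _ h =>
      rintro x y hxy ⟨s, hs, hy⟩
      exact ⟨s, hs, h s hs x y hxy hy⟩
  have t1max : @T1Space X (xTopTopology X) → ∀ x ∈ X, x ∈ maxSet X := by
    intro hT x hx
    refine ⟨hx, fun y hy hxy => ?_⟩
    by_contra hne
    have hc : @IsOpen X (xTopTopology X) ({(⟨x, hx⟩ : X)}ᶜ) :=
      (@isOpen_compl_singleton X (xTopTopology X) _ ⟨x, hx⟩)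
    exact low _ hc ⟨x, hx⟩ ⟨y, hy⟩ hxy (fun h => hne (congrArg Subtype.val h).symm) rfl
  have P1 : (∀ x ∈ X, ¬ sInf (X \ {x}) ≤ x) → xTopTopology X = ⊥ := by
    intro hP
    refine eq_bot_of_singletons_open ?_
    rintro ⟨x, hx⟩
    refine TopologicalSpace.GenerateOpen.basic _ ⟨sInf (X \ {x}), ?_⟩
    ext ⟨y, hy⟩
    constructor
    · intro h
      have h' : y = x := congrArg Subtype.val h
      subst h'
      exact hP y hx
    · intro h
      by_contra hne
      exact h (sInf_le ⟨hy, fun e => hne (Subtype.ext e)⟩)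
  tfae_have 2 → 1 := by
    intro h
    refine P1 fun x hx hle => ?_
    obtain ⟨a, ha, hax⟩ := (h x hx).2 _ Set.diff_subset hle
    exact ha.2 ((h x hx).1 a ha.1 hax)
  tfae_have 3 → 2 := by
    intro h
    have e := emin fun x hx => (h x hx).1
    rw [e] at h
    intro x hx
    refine ⟨hmin (fun x hx => (h x hx).2) x hx, fun A hA hle => ?_⟩
    by_contra hne
    refine (h x hx).2 ((sInf_le_sInf ?_).trans hle)
    exact fun a ha => ⟨hA ha, fun e => hne ⟨a, ha, le_of_eq e⟩⟩
  tfae_have 4 → 3 := by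
    intro h
    have e := emax fun x hx => (h x hx).1
    rw [e] at h
    have hm := hmin fun x hx => (h x hx).2
    rw [emin fun x hx => ⟨hx, hm x hx⟩]
    exact h
  tfae_have 5 → 4 := by
    rintro ⟨h1, h2⟩ x hx
    exact ⟨t1max h1 x hx, h2 x (t1max h1 x hx)⟩
  tfae_have 1 → 5 := by
    intro h
    have hT : @T1Space X (xTopTopology X) := by
      rw [h]
      letI : TopologicalSpace X := ⊥
      haveI : DiscreteTopology X := ⟨rfl⟩
      infer_instance
    refine ⟨hT, ?_⟩
    have e := emax (t1max hT)
    rw [e]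
    intro x hx hle
    have ho : @IsOpen X (xTopTopology X) ({(⟨x, hx⟩ : X)}) := by rw [h]; trivial
    -- every open set containing a point contains a complement of a variety around it
    have key : ∀ U : Set X, @IsOpen X (xTopTopology X) U → ∀ x ∈ U, U = Set.univ ∨
        ∃ a, x ∉ zarV X a ∧ (zarV X a)ᶜ ⊆ U := by
      intro U hU
      induction hU with
      | basic s hs =>
        obtain ⟨a, rfl⟩ := hs
        exact fun x hx => Or.inr ⟨a, hx, subset_rfl⟩
      | univ => exact fun _ _ => Or.inl rfl
      | inter s t _ _ h1 h2 =>
        rintro x ⟨hs, ht⟩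
        rcases h1 x hs with rfl | ⟨a, ha, ha'⟩
        · simpa using h2 x ht
        rcases h2 x ht with rfl | ⟨b, hb, hb'⟩
        · exact Or.inr ⟨a, ha, by simpa using ha'⟩
        obtain ⟨c, hc⟩ := hXtop a b
        refine Or.inr ⟨c, ?_, ?_⟩
        · rw [← hc]; rintro (h | h)
          · exact ha h
          · exact hb h
        · rw [← hc]
          exact fun y hy => ⟨ha' fun h => hy (Or.inl h), hb' fun h => hy (Or.inr h)⟩
      | sUnion S _ h =>
        rintro x ⟨s, hs, hx⟩
        rcases h s hs x hx with rfl | ⟨a, ha, ha'⟩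
        · exact Or.inl (Set.eq_univ_of_univ_subset (Set.subset_sUnion_of_mem hs))
        · exact Or.inr ⟨a, ha, ha'.trans (Set.subset_sUnion_of_mem hs)⟩
    rcases key _ ho _ rfl with hu | ⟨a, ha, ha'⟩
    · have : X \ {x} = ∅ := by
        ext y
        simp only [Set.mem_diff, Set.mem_singleton_iff, Set.mem_empty_iff_false, iff_false]
        rintro ⟨hy, hne⟩
        have : (⟨y, hy⟩ : X) ∈ ({(⟨x, hx⟩ : X)} : Set X) := by rw [hu]; trivial
        exact hne (congrArg Subtype.val this)
      rw [this, sInf_empty, top_le_iff] at hle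
      exact hX (hle ▸ hx)
    · refine ha (le_trans (le_sInf ?_) hle)
      rintro y ⟨hy, hne⟩
      by_contra hay
      exact hne (congrArg Subtype.val (ha' (show (⟨y, hy⟩ : X) ∈ (zarV X a)ᶜ from hay)))
  tfae_finish
end

section
/- Let R be a commutative semiring. The following are equivalent: (1) for every maximal ideal m of R, the intersection of all the other maximal ideals of R is not contained in m (i.e. every maximal ideal is barely maximal); (2) the set of maximal ideals of R, viewed as a subspace of the prime spectrum of R with the Zariski topology, is discrete; (3) R has only finitely many maximal ideals. -/
theorem bmax_tfae {R : Type*} [CommSemiring R] :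
    List.TFAE [
      ∀ m : Ideal R, m.IsMaximal → ¬ sInf {m' : Ideal R | m'.IsMaximal ∧ m' ≠ m} ≤ m,
      DiscreteTopology {p : PrimeSpectrum R | p.asIdeal.IsMaximal},
      {m : Ideal R | m.IsMaximal}.Finite] := by
  tfae_have 1 → 3 := by
    intro h
    have h' : ∀ m : {m : Ideal R // m.IsMaximal},
        ∃ x, x ∈ sInf {m' : Ideal R | m'.IsMaximal ∧ m' ≠ m.1} ∧ x ∉ m.1 := by
      intro m
      exact SetLike.not_le_iff_exists.mp (h m.1 m.2)
    choose x hx hxm using h'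
    have htop : Ideal.span (Set.range x) = ⊤ := by
      by_contra hne
      obtain ⟨M, hM, hle⟩ := Ideal.exists_le_maximal _ hne
      exact hxm ⟨M, hM⟩ (hle (Ideal.subset_span ⟨⟨M, hM⟩, rfl⟩))
    obtain ⟨t, hts, ht⟩ := (Ideal.span_eq_top_iff_finite _).mp htop
    have key : ∀ y : R, y ∈ t → ∃ m, x m = y := fun y hy => hts hy
    choose f hf using fun y : t => key y.1 y.2
    refine (Set.finite_range (fun y : t => (f y).1)).subset ?_
    intro M hM
    by_contra hMn
    apply hM.ne_top
    rw [eq_top_iff, ← ht, Ideal.span_le]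
    intro y hy
    have h1 := hx (f ⟨y, hy⟩)
    rw [hf ⟨y, hy⟩] at h1
    refine (Submodule.mem_sInf.mp h1) M ⟨hM, ?_⟩
    intro he
    exact hMn ⟨⟨y, hy⟩, he.symm⟩
  tfae_have 3 → 1 := by
    intro hfin m hm hle
    have hf2 : {m' : Ideal R | m'.IsMaximal ∧ m' ≠ m}.Finite := hfin.subset fun _ h => h.1
    have h2 : hf2.toFinset.inf id ≤ m := by
      rw [Finset.inf_id_eq_sInf]
      simpa using hle
    obtain ⟨m', hm', hl⟩ := (Ideal.IsPrime.inf_le' hm.isPrime).mp h2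
    have h3 := (hf2.mem_toFinset).mp hm'
    exact h3.2 (h3.1.eq_of_le hm.ne_top hl)
  tfae_have 2 → 1 := by
    intro hd m hm hle
    obtain ⟨U, hU, hUm⟩ := isOpen_induced_iff.mp
      (isOpen_discrete ({⟨⟨m, hm.isPrime⟩, hm⟩} : Set {p : PrimeSpectrum R | p.asIdeal.IsMaximal}))
    obtain ⟨s, hs⟩ := (PrimeSpectrum.isOpen_iff U).mp hU
    have hmU : (⟨m, hm.isPrime⟩ : PrimeSpectrum R) ∈ U := by
      have := hUm.symm.subset (Set.mem_singleton _)
      exact this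
    have : (⟨m, hm.isPrime⟩ : PrimeSpectrum R) ∈ Uᶜ := by
      rw [hs, PrimeSpectrum.mem_zeroLocus]
      intro y hy
      refine hle (Submodule.mem_sInf.mpr ?_)
      rintro m' ⟨hm', hne⟩
      have h4 : (⟨m', hm'.isPrime⟩ : PrimeSpectrum R) ∈ Uᶜ := by
        intro h5
        have h6 := hUm.subset (show (⟨⟨m', hm'.isPrime⟩, hm'⟩ :
          {p : PrimeSpectrum R | p.asIdeal.IsMaximal}) ∈ _ from h5)
        exact hne (congrArg (fun p => p.1.asIdeal) h6)
      rw [hs, PrimeSpectrum.mem_zeroLocus] at h4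
      exact h4 hy
    exact this hmU
  tfae_have 1 → 2 := by
    intro h
    rw [discreteTopology_iff_isOpen_singleton]
    rintro ⟨p, hp⟩
    obtain ⟨x, hx, hxm⟩ := SetLike.not_le_iff_exists.mp (h p.asIdeal hp)
    refine isOpen_induced_iff.mpr
      ⟨PrimeSpectrum.basicOpen x, (PrimeSpectrum.basicOpen x).isOpen, ?_⟩
    ext ⟨q, hq⟩
    constructor
    · intro hxq
      by_contra hne
      exact hxq ((Submodule.mem_sInf.mp hx) q.asIdeal
        ⟨hq, fun he => hne (Subtype.ext (PrimeSpectrum.ext he))⟩)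
    · intro he
      have : q = p := congrArg Subtype.val he
      subst this
      exact hxm
  tfae_finish
end

section
/- Let R be a commutative semiring. The following are equivalent: (1) every minimal prime ideal of R is absolutely minimal, i.e. for every minimal prime q of R, the intersection of all the other minimal primes of R is not contained in q; (2) the set of minimal prime ideals of R, viewed as a subspace of the prime spectrum of R with the Zariski topology, is discrete; (3) the intersection of all minimal primes of R is an irredundant intersection (removing any one minimal prime strictly enlarges the intersection). -/
/-- `q` is a minimal prime ideal of `R`. -/
def IsMinPrime {R : Type*} [CommSemiring R] (q : Ideal R) : Prop :=
  q.IsPrime ∧ ∀ p : Ideal R, p.IsPrime → p ≤ q → p = q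

theorem amin_tfae {R : Type*} [CommSemiring R] :
    List.TFAE [
      ∀ q : Ideal R, IsMinPrime q → ¬ sInf {q' : Ideal R | IsMinPrime q' ∧ q' ≠ q} ≤ q,
      DiscreteTopology {p : PrimeSpectrum R | IsMinPrime p.asIdeal},
      ∀ q : Ideal R, IsMinPrime q →
        sInf {q' : Ideal R | IsMinPrime q'} < sInf {q' : Ideal R | IsMinPrime q' ∧ q' ≠ q}] := by
  tfae_have 1 → 2 := by
    intro h
    rw [discreteTopology_subtype_iff']
    intro q hq
    obtain ⟨a, ha, haq⟩ := SetLike.not_le_iff_exists.mp (h q.asIdeal hq)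
    refine ⟨PrimeSpectrum.basicOpen a, PrimeSpectrum.isOpen_basicOpen, ?_⟩
    ext p
    constructor
    · rintro ⟨hp, hpm⟩
      by_contra hne
      refine hp ((Submodule.mem_sInf.mp ha) p.asIdeal ⟨hpm, fun e => hne ?_⟩)
      exact PrimeSpectrum.ext e
    · rintro rfl
      exact ⟨haq, hq⟩
  tfae_have 2 → 1 := by
    intro h q hq hle
    rw [discreteTopology_subtype_iff'] at h
    obtain ⟨U, hU, hUq⟩ := h ⟨q, hq.1⟩ hq
    obtain ⟨s, hs⟩ := (PrimeSpectrum.isOpen_iff U).mp hU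
    have hqU : (⟨q, hq.1⟩ : PrimeSpectrum R) ∈ U := (hUq.symm.subset rfl).1
    have hqs : (⟨q, hq.1⟩ : PrimeSpectrum R) ∉ PrimeSpectrum.zeroLocus s := by
      rw [← hs]; exact fun h => h hqU
    apply hqs
    intro a ha
    refine hle (Submodule.mem_sInf.mpr ?_)
    rintro p ⟨hp, hne⟩
    have : (⟨p, hp.1⟩ : PrimeSpectrum R) ∈ PrimeSpectrum.zeroLocus s := by
      rw [← hs]
      intro hpU
      exact hne (congrArg PrimeSpectrum.asIdeal (hUq.subset ⟨hpU, hp⟩))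
    exact this ha
  tfae_have 1 → 3 := by
    intro h q hq
    refine lt_of_le_not_ge (sInf_le_sInf fun p hp => hp.1) fun hle => h q hq ?_
    exact hle.trans (sInf_le hq)
  tfae_have 3 → 1 := by
    intro h q hq hle
    refine (h q hq).not_ge (le_sInf fun p hp => ?_)
    by_cases e : p = q
    · rw [e]; exact hle
    · exact sInf_le ⟨hp, e⟩
  tfae_finish
end

section
/- Let R be a commutative ring. The Zariski topology on the prime spectrum Spec(R) is discrete if and only if R has only finitely many maximal ideals and R is π-regular (for every a ∈ R there exist an integer n ≥ 1 and b ∈ R with aⁿ = aⁿ·b·aⁿ). -/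
theorem spec_discrete_iff_fmax_and_piRegular {R : Type*} [CommRing R] :
    DiscreteTopology (PrimeSpectrum R) ↔
      {m : Ideal R | m.IsMaximal}.Finite ∧
      ∀ a : R, ∃ n : ℕ, 1 ≤ n ∧ ∃ b : R, a ^ n = a ^ n * b * a ^ n := by
  rw [PrimeSpectrum.discreteTopology_iff_finite_and_krullDimLE_zero]
  constructor
  · rintro ⟨hf, hd⟩
    constructor
    · refine (Set.finite_range (fun p : PrimeSpectrum R => p.asIdeal)).subset ?_
      intro m hm
      exact ⟨⟨m, Ideal.IsMaximal.isPrime hm⟩, rfl⟩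
    · intro a
      have key : ∃ (n : ℕ) (x : R), a ^ n * (1 - a * x) = 0 := by
        let S : Submonoid R :=
          { carrier := {s | ∃ (n : ℕ) (x : R), s = a ^ n * (1 - a * x)}
            one_mem' := ⟨0, 0, by simp⟩
            mul_mem' := by
              rintro _ _ ⟨n, x, rfl⟩ ⟨m, y, rfl⟩
              exact ⟨n + m, x + y - a * x * y, by ring⟩ }
        by_contra hcon
        have hdis : Disjoint ((⊥ : Ideal R) : Set R) (S : Set R) := by
          rw [Set.disjoint_left]
          rintro s hs ⟨n, x, hx⟩
          have h0 : s = 0 := by simpa using hs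
          exact hcon ⟨n, x, by rw [← hx, h0]⟩
        obtain ⟨P, hP, -, hPS⟩ := Ideal.exists_le_prime_disjoint ⊥ S hdis
        rw [Set.disjoint_left] at hPS
        have hmax : P.IsMaximal := Ideal.IsPrime.isMaximal' hP
        have ha : a ∉ P := fun h => hPS h ⟨1, 0, by simp⟩
        obtain ⟨y, i, hi, hy⟩ := hmax.exists_inv ha
        refine hPS hi ⟨0, y, ?_⟩
        linear_combination hy
      obtain ⟨n, x, h⟩ := key
      have h1 : ∀ k : ℕ, a ^ (n + 1) = a ^ (n + 1) * (a * x) ^ k := by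
        intro k
        induction k with
        | zero => simp
        | succ k ih =>
          rw [pow_succ (a * x)]
          linear_combination ih + a * (a * x) ^ k * h
      refine ⟨n + 1, by omega, x ^ (n + 1), ?_⟩
      have h2 := h1 (n + 1)
      rw [mul_pow] at h2
      linear_combination h2
  · rintro ⟨hf, hr⟩
    have hmax : ∀ I : Ideal R, I.IsPrime → I.IsMaximal := by
      intro P hP
      rw [Ideal.isMaximal_iff]
      refine ⟨fun h => hP.ne_top ((Ideal.eq_top_iff_one P).2 h), ?_⟩
      intro J a hPJ haP haJ
      obtain ⟨n, hn, b, hb⟩ := hr a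
      have h0 : a ^ n * (1 - b * a ^ n) ∈ P := by
        have : a ^ n * (1 - b * a ^ n) = 0 := by linear_combination hb
        rw [this]; exact P.zero_mem
      rcases hP.mem_or_mem h0 with h | h
      · exact absurd (hP.mem_of_pow_mem n h) haP
      · have h3 : b * a ^ n ∈ J := J.mul_mem_left b (J.pow_mem_of_mem haJ n hn)
        have := J.add_mem (hPJ h) h3
        simpa using this
    refine ⟨?_, Ring.KrullDimLE.mk₀ hmax⟩
    have : Finite {m : Ideal R | m.IsMaximal} := hf
    refine Finite.of_injective
      (fun p : PrimeSpectrum R => (⟨p.asIdeal, hmax _ p.isPrime⟩ : {m : Ideal R | m.IsMaximal})) ?_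
    intro p q h
    exact PrimeSpectrum.ext (congrArg Subtype.val h)
end

section
/- Let R be a commutative semiring and give the prime spectrum Spec(R) the Zariski topology. The following are equivalent: (1) Spec(R) is T_{1/4}, i.e. every point p of Spec(R) is either closed or kerneled ({p} equals the intersection of all open sets containing p); (2) the Krull dimension of Spec(R) is at most 1 (equivalently, every prime ideal of R is maximal or a minimal prime); (3) Spec(R) is T_F, i.e. for every point p and every finite set F of points with p ∉ F, either there is an open set containing p and disjoint from F, or there is an open set containing F and not containing p. -/
theorem spec_t_quarter_tfae {R : Type*} [CommSemiring R] :
    List.TFAE [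
      ∀ p : PrimeSpectrum R, IsClosed ({p} : Set (PrimeSpectrum R)) ∨
        (⋂ U ∈ {U : Set (PrimeSpectrum R) | IsOpen U ∧ p ∈ U}, U) = {p},
      Order.krullDim (PrimeSpectrum R) ≤ 1,
      ∀ (p : PrimeSpectrum R) (F : Finset (PrimeSpectrum R)), p ∉ F →
        (∃ U : Set (PrimeSpectrum R), IsOpen U ∧ p ∈ U ∧ ∀ q ∈ F, q ∉ U) ∨
        (∃ U : Set (PrimeSpectrum R), IsOpen U ∧ (∀ q ∈ F, q ∈ U) ∧ p ∉ U)] := by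
  classical
  have hop : ∀ (x y : PrimeSpectrum R), x ≤ y → ∀ U, IsOpen U → y ∈ U → x ∈ U := by
    intro x y h U hU hy
    exact ((PrimeSpectrum.le_iff_specializes x y).1 h).mem_open hU hy
  have hcl : ∀ p x : PrimeSpectrum R, x ∈ closure {p} ↔ p ≤ x := fun p x =>
    (PrimeSpectrum.le_iff_mem_closure p x).symm
  have h1 : ∀ p : PrimeSpectrum R, IsClosed ({p} : Set (PrimeSpectrum R)) ↔ IsMax p := by
    intro p
    constructor
    · intro h x hx
      have := (hcl p x).2 hx
      rw [h.closure_eq] at this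
      exact le_of_eq this
    · intro h
      rw [← closure_subset_iff_isClosed]
      intro x hx
      have := (hcl p x).1 hx
      exact le_antisymm (h this) this
  have h2 : ∀ p : PrimeSpectrum R,
      (⋂ U ∈ {U : Set (PrimeSpectrum R) | IsOpen U ∧ p ∈ U}, U) = {p} ↔ IsMin p := by
    intro p
    constructor
    · intro h x hx
      have : x ∈ (⋂ U ∈ {U : Set (PrimeSpectrum R) | IsOpen U ∧ p ∈ U}, U) := by
        simp only [Set.mem_iInter]
        intro U hU
        exact hop x p hx U hU.1 hU.2
      rw [h] at this
      exact le_of_eq this.symm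
    · intro h
      apply Set.Subset.antisymm
      · intro x hx
        simp only [Set.mem_iInter] at hx
        have hxp : x ≤ p := by
          by_contra hn
          exact hx (closure {x})ᶜ ⟨isClosed_closure.isOpen_compl, fun hp => hn ((hcl x p).1 hp)⟩
            (subset_closure rfl)
        exact le_antisymm hxp (h hxp)
      · rintro x rfl
        simp only [Set.mem_iInter]
        exact fun U hU => hU.2
  tfae_have 1 ↔ 2 := by
    rw [Order.krullDim_le_one_iff]
    simp only [h1, h2, or_comm]
  tfae_have 2 → 3 := by
    rw [Order.krullDim_le_one_iff]
    intro h p F hp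
    rcases h p with h | h
    · left
      refine ⟨(⋃ q ∈ F, closure {q})ᶜ,
        (F.finite_toSet.isClosed_biUnion fun _ _ => isClosed_closure).isOpen_compl, ?_, ?_⟩
      · simp only [Set.mem_compl_iff, Set.mem_iUnion, not_exists]
        intro q hq hpq
        have := (hcl q p).1 hpq
        exact hp (le_antisymm (h this) this ▸ hq)
      · intro q hq hn
        exact hn (Set.mem_biUnion hq (subset_closure rfl))
    · right
      refine ⟨{p}ᶜ, ((h1 p).2 h).isOpen_compl, ?_, by simp⟩
      rintro q hq rfl
      exact hp hq
  tfae_have 3 → 2 := by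
    rw [Order.krullDim_le_one_iff]
    intro h p
    by_contra! hc
    obtain ⟨hmin, hmax⟩ := hc
    obtain ⟨a, ha⟩ := not_isMin_iff.1 hmin
    obtain ⟨b, hb⟩ := not_isMax_iff.1 hmax
    rcases h p {a, b} (by simp [ha.ne', hb.ne]) with ⟨U, hU, hp, hF⟩ | ⟨U, hU, hF, hp⟩
    · exact hF a (by simp) (hop a p ha.le U hU hp)
    · exact hp (hop p b hb.le U hU (hF b (by simp)))
  tfae_finish
end

section
/- Let R be a commutative semiring and give the prime spectrum Spec(R) the Zariski topology. Then Spec(R) is T_{1/2} (every point is either closed or isolated) if and only if the Krull dimension of Spec(R) is at most 1 and R is an ES-semiring, i.e. for every minimal prime p of R that is not a maximal ideal, the intersection of all prime ideals of R other than p is not contained in p. -/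
theorem spec_isOpen_aux {R : Type*} [CommSemiring R] (p : PrimeSpectrum R) :
    IsOpen ({p} : Set (PrimeSpectrum R)) ↔
      ¬ sInf {q : Ideal R | q.IsPrime ∧ q ≠ p.asIdeal} ≤ p.asIdeal := by
  rw [SetLike.not_le_iff_exists]
  constructor
  · intro h
    obtain ⟨s, hs⟩ := (PrimeSpectrum.isOpen_iff _).1 h
    have hp : p ∉ PrimeSpectrum.zeroLocus s := by
      rw [← hs]; simp
    rw [PrimeSpectrum.mem_zeroLocus, Set.not_subset] at hp
    obtain ⟨f, hfs, hfp⟩ := hp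
    refine ⟨f, ?_, hfp⟩
    rw [Ideal.mem_sInf]
    rintro q ⟨hq, hne⟩
    have : (⟨q, hq⟩ : PrimeSpectrum R) ∈ PrimeSpectrum.zeroLocus s := by
      rw [← hs]
      intro h
      apply hne
      rw [← Set.mem_singleton_iff.1 h]
    exact this hfs
  · rintro ⟨f, hf, hfp⟩
    have : ({p} : Set (PrimeSpectrum R)) = PrimeSpectrum.basicOpen f := by
      ext q
      rw [Set.mem_singleton_iff, SetLike.mem_coe, PrimeSpectrum.mem_basicOpen]
      constructor
      · rintro rfl; exact hfp
      · intro h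
        by_contra hne
        exact h (Ideal.mem_sInf.1 hf ⟨q.isPrime, fun e => hne (PrimeSpectrum.ext e)⟩)
    rw [this]
    exact PrimeSpectrum.isOpen_basicOpen

theorem spec_t_half_iff {R : Type*} [CommSemiring R] :
    (∀ p : PrimeSpectrum R, IsClosed ({p} : Set (PrimeSpectrum R)) ∨
        IsOpen ({p} : Set (PrimeSpectrum R))) ↔
      Order.krullDim (PrimeSpectrum R) ≤ 1 ∧
      ∀ p : Ideal R, IsMinPrime p → ¬ p.IsMaximal →
        ¬ sInf {q : Ideal R | q.IsPrime ∧ q ≠ p} ≤ p := by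
  rw [Order.krullDim_le_one_iff]
  constructor
  · intro h
    constructor
    · intro p
      rcases h p with h | h
      · right
        rw [PrimeSpectrum.isClosed_singleton_iff_isMaximal] at h
        intro q hq
        exact (PrimeSpectrum.ext (h.eq_of_le q.isPrime.ne_top hq)).ge
      · left
        intro q hq
        by_contra hne
        have hmem : q.asIdeal ∈ {q : Ideal R | q.IsPrime ∧ q ≠ p.asIdeal} :=
          ⟨q.isPrime, fun e => hne (PrimeSpectrum.ext e).ge⟩
        exact (spec_isOpen_aux p).1 h ((sInf_le hmem).trans hq)
    · intro p hp hm
      rcases h ⟨p, hp.1⟩ with h | h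
      · exact absurd ((PrimeSpectrum.isClosed_singleton_iff_isMaximal _).1 h) hm
      · exact (spec_isOpen_aux _).1 h
  · rintro ⟨hd, he⟩ p
    rw [PrimeSpectrum.isClosed_singleton_iff_isMaximal, spec_isOpen_aux]
    by_cases hm : p.asIdeal.IsMaximal
    · exact Or.inl hm
    right
    refine he _ ⟨p.isPrime, fun q hq hqp => ?_⟩ hm
    rcases hd p with h | h
    · exact le_antisymm hqp (@h ⟨q, hq⟩ hqp)
    · exfalso
      obtain ⟨m, hmm, hle⟩ := Ideal.exists_le_maximal _ p.isPrime.ne_top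
      have h2 : m ≤ p.asIdeal := @h ⟨m, hmm.isPrime⟩ hle
      exact hm (le_antisymm h2 hle ▸ hmm)
end

section
/- Let L be a complete lattice that is an X-top lattice for a subset X of L not containing ⊤, with X carrying the X-top topology. For x ∈ X the following are equivalent: (1) x is regular open, i.e. {x} equals the interior of the closure of {x}; (2) the closure of D(x) = {y ∈ X | x ≰ y} equals X \ {x}; (3) x is isolated ({x} is open) and the infimum of X \ {x} equals the infimum of D(x). -/
theorem xtop_closed_ex {L : Type*} [CompleteLattice L] (X : Set L)
    (hX : ⊤ ∉ X) (hXtop : IsXTop X) (U : Set X) (hU : @IsOpen X (xTopTopology X) U) :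
    ∃ a : L, Uᶜ = zarV X a := by
  have hU' : TopologicalSpace.GenerateOpen {U : Set X | ∃ a : L, U = (zarV X a)ᶜ} U := hU
  induction hU' with
  | basic s hs => obtain ⟨a, rfl⟩ := hs; exact ⟨a, compl_compl _⟩
  | univ => exact ⟨⊤, by
      ext y; simp only [zarV, Set.compl_univ, Set.mem_empty_iff_false, Set.mem_ofPred_eq, top_le_iff, false_iff]; intro h; exact hX (h ▸ y.2)⟩
  | inter s t hs ht ihs iht =>
    obtain ⟨a, ha⟩ := ihs hs
    obtain ⟨b, hb⟩ := iht ht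
    obtain ⟨c, hc⟩ := hXtop a b
    exact ⟨c, by rw [Set.compl_inter, ha, hb, hc]⟩
  | sUnion S hS ih =>
    choose! f hf using fun s hs => ih s hs (hS s hs)
    refine ⟨sSup (f '' S), ?_⟩
    ext y
    simp only [Set.mem_compl_iff, Set.mem_sUnion, not_exists, not_and, zarV, Set.mem_ofPred_eq,
      sSup_le_iff, Set.forall_mem_image]
    refine forall₂_congr fun s hs => ?_
    have := Set.ext_iff.1 (hf s hs) y
    simpa [zarV] using this

theorem xtop_closure {L : Type*} [CompleteLattice L] (X : Set L)
    (hX : ⊤ ∉ X) (hXtop : IsXTop X) (S : Set X) :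
    @closure X (xTopTopology X) S = zarV X (sInf (Subtype.val '' S)) := by
  letI := xTopTopology X
  apply subset_antisymm
  · apply closure_minimal
    · intro y hy
      exact sInf_le ⟨y, hy, rfl⟩
    · exact ⟨TopologicalSpace.GenerateOpen.basic _ ⟨_, rfl⟩⟩
  · obtain ⟨a, ha⟩ := xtop_closed_ex X hX hXtop (closure S)ᶜ isClosed_closure.isOpen_compl
    rw [compl_compl] at ha
    rw [ha]
    intro y hy
    refine le_trans (le_sInf ?_) hy
    rintro _ ⟨z, hz, rfl⟩
    have : z ∈ zarV X a := ha ▸ subset_closure hz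
    exact this

theorem xtop_regular_open_tfae {L : Type*} [CompleteLattice L] (X : Set L)
    (hX : ⊤ ∉ X) (hXtop : IsXTop X) (x : X) :
    List.TFAE [
      ({x} : Set X) = @interior X (xTopTopology X) (@closure X (xTopTopology X) {x}),
      @closure X (xTopTopology X) {y : X | ¬ (x : L) ≤ (y : L)} = ({x} : Set X)ᶜ,
      @IsOpen X (xTopTopology X) {x} ∧
        sInf {y : L | y ∈ X ∧ y ≠ (x : L)} = sInf {y : L | y ∈ X ∧ ¬ (x : L) ≤ y}] := by
  letI := xTopTopology X
  have hcl := xtop_closure X hX hXtop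
  have e1 : Subtype.val '' {y : X | ¬ (x : L) ≤ (y : L)} = {y : L | y ∈ X ∧ ¬ (x : L) ≤ y} := by
    ext y
    constructor
    · rintro ⟨z, hz, rfl⟩
      exact ⟨z.2, hz⟩
    · rintro ⟨h1, h2⟩
      exact ⟨⟨y, h1⟩, h2, rfl⟩
  have e2 : Subtype.val '' ({x} : Set X)ᶜ = {y : L | y ∈ X ∧ y ≠ (x : L)} := by
    ext y; simp [Subtype.ext_iff]
  tfae_have 1 ↔ 2 := by
    have h : {y : X | ¬ (x : L) ≤ (y : L)} = (closure {x})ᶜ := by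
      rw [hcl]; ext y; simp [zarV]
    rw [h, closure_compl, compl_inj_iff, eq_comm]
  tfae_have 2 → 3 := by
    intro h
    refine ⟨?_, le_antisymm ?_ ?_⟩
    · rw [← isClosed_compl_iff, ← h]; exact isClosed_closure
    · exact sInf_le_sInf fun y hy => ⟨hy.1, fun e => hy.2 e.ge⟩
    · rw [hcl, e1] at h
      refine le_sInf fun y hy => ?_
      have : (⟨y, hy.1⟩ : X) ∈ ({x} : Set X)ᶜ := fun e => hy.2 (congrArg Subtype.val e)
      rw [← h] at this
      exact this
  tfae_have 3 → 2 := by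
    rintro ⟨ho, he⟩
    rw [hcl, e1, ← he, ← e2, ← hcl]
    exact ho.isClosed_compl.closure_eq
  tfae_finish
end

section
/- Let L be a complete lattice that is an X-top lattice for a subset X of L not containing ⊤, with X carrying the X-top topology. Then X is T_{3/4} (every point is either closed or regular open) if and only if every x ∈ X is either a maximal element of X, or simultaneously: a minimal element of X, completely strongly X-irreducible (for every A ⊆ X with ⨅ A ≤ x there is a ∈ A with a ≤ x), and excluded (the infimum of X \ {x} equals the infimum of D(x) = {y ∈ X | x ≰ y}). -/
theorem xtop_isOpen_iff {L : Type*} [CompleteLattice L] (X : Set L)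
    (hX : ⊤ ∉ X) (hXtop : IsXTop X) (U : Set X) :
    @IsOpen X (xTopTopology X) U ↔ ∃ a : L, U = (zarV X a)ᶜ := by
  constructor
  · intro h
    change TopologicalSpace.GenerateOpen _ U at h
    induction h with
    | basic s hs => exact hs
    | univ =>
      refine ⟨⊤, ?_⟩
      ext y
      simp only [Set.mem_univ, Set.mem_compl_iff, zarV, Set.mem_setOf_eq, true_iff, top_le_iff]
      intro h
      exact hX (h ▸ y.2)
    | inter s t _ _ hs ht =>
      obtain ⟨a, rfl⟩ := hs
      obtain ⟨b, rfl⟩ := ht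
      obtain ⟨c, hc⟩ := hXtop a b
      exact ⟨c, by rw [← hc, Set.compl_union]⟩
    | sUnion S _ hS =>
      refine ⟨sSup {a | (zarV X a)ᶜ ∈ S}, ?_⟩
      ext y
      simp only [Set.mem_sUnion, Set.mem_compl_iff, zarV, Set.mem_setOf_eq, sSup_le_iff, not_forall]
      constructor
      · rintro ⟨s, hs, hy⟩
        obtain ⟨a, rfl⟩ := hS s hs
        exact ⟨a, hs, hy⟩
      · rintro ⟨a, ha, hy⟩
        exact ⟨_, ha, hy⟩
  · intro h
    exact TopologicalSpace.GenerateOpen.basic _ h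

theorem xtop_t_three_quarters_iff {L : Type*} [CompleteLattice L] (X : Set L)
    (hX : ⊤ ∉ X) (hXtop : IsXTop X) :
    (∀ x : X, @IsClosed X (xTopTopology X) {x} ∨
      ({x} : Set X) = @interior X (xTopTopology X) (@closure X (xTopTopology X) {x})) ↔
    ∀ x : X, (∀ y ∈ X, (x : L) ≤ y → y = (x : L)) ∨
      ((∀ y ∈ X, y ≤ (x : L) → y = (x : L)) ∧
       (∀ A ⊆ X, sInf A ≤ (x : L) → ∃ a ∈ A, a ≤ (x : L)) ∧
       sInf {y : L | y ∈ X ∧ y ≠ (x : L)} = sInf {y : L | y ∈ X ∧ ¬ (x : L) ≤ y}) := by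
  have hcl : ∀ x : X, @closure X (xTopTopology X) {x} = zarV X (x : L) := by
    intro x
    rw [xtop_closure X hX hXtop]
    simp
  refine forall_congr' fun x => or_congr ?_ ?_
  · rw [← @closure_eq_iff_isClosed X (xTopTopology X), hcl, Set.ext_iff]
    constructor
    · intro h y hy hxy
      exact congrArg Subtype.val ((h ⟨y, hy⟩).1 hxy)
    · intro h y
      constructor
      · intro hy
        exact Subtype.ext (h y y.2 hy)
      · rintro rfl
        exact le_refl (_ : L)
  · have hD : Subtype.val '' (zarV X (x : L))ᶜ = {y : L | y ∈ X ∧ ¬ (x : L) ≤ y} := by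
      ext y
      constructor
      · rintro ⟨z, hz, rfl⟩
        exact ⟨z.2, hz⟩
      · rintro ⟨h1, h2⟩
        exact ⟨⟨y, h1⟩, h2, rfl⟩
    rw [hcl, @interior_eq_compl_closure_compl X (xTopTopology X),
      xtop_closure X hX hXtop, hD, Set.ext_iff]
    constructor
    · intro h
      have hx : ¬ sInf {y : L | y ∈ X ∧ ¬ (x : L) ≤ y} ≤ (x : L) := (h x).1 rfl
      have hy : ∀ y ∈ X, y ≠ (x : L) → sInf {y : L | y ∈ X ∧ ¬ (x : L) ≤ y} ≤ y := by
        intro y hy hne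
        by_contra hc
        exact hne (congrArg Subtype.val ((h ⟨y, hy⟩).2 hc))
      refine ⟨?_, ?_, ?_⟩
      · intro y hyX hyx
        by_contra hne
        exact hx ((hy y hyX hne).trans hyx)
      · intro A hA hAx
        by_cases hxA : (x : L) ∈ A
        · exact ⟨x, hxA, le_rfl⟩
        · refine absurd (le_trans (le_sInf ?_) hAx) hx
          intro a ha
          exact hy a (hA ha) (fun e => hxA (e ▸ ha))
      · apply le_antisymm
        · apply sInf_le_sInf
          rintro y ⟨h1, h2⟩
          exact ⟨h1, fun e => h2 e.ge⟩
        · exact le_sInf fun y hy' => hy y hy'.1 hy'.2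
    · rintro ⟨hmin, hirr, hexc⟩ y
      constructor
      · rintro rfl hle
        obtain ⟨a, ⟨haX, hna⟩, hay⟩ := hirr _ (fun z hz => hz.1) hle
        exact hna (hmin a haX hay).ge
      · intro hy
        by_contra hne
        apply hy
        change sInf _ ≤ (y : L)
        rw [← hexc]
        exact sInf_le ⟨y.2, fun e => hne (Subtype.ext e)⟩
end

section
/- Let R be a commutative semiring that is local (it has a unique maximal ideal), such that the prime spectrum Spec(R) is finite, every prime ideal of R other than the maximal ideal is a minimal prime, and R has at least two minimal primes. Then, in the Zariski topology, every point of Spec(R) is either closed or regular open (Spec(R) is T_{3/4}), but Spec(R) is not a T₁ space. -/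
theorem local_tree_spec_t_three_quarters {R : Type*} [CommSemiring R]
    (hloc : ∃! m : Ideal R, m.IsMaximal)
    (hfin : Finite (PrimeSpectrum R))
    (hmin : ∀ p : Ideal R, p.IsPrime → ¬ p.IsMaximal → IsMinPrime p)
    (htwo : ∃ q₁ q₂ : Ideal R, IsMinPrime q₁ ∧ IsMinPrime q₂ ∧ q₁ ≠ q₂) :
    (∀ p : PrimeSpectrum R, IsClosed ({p} : Set (PrimeSpectrum R)) ∨
      ({p} : Set (PrimeSpectrum R)) = interior (closure {p})) ∧
    ¬ T1Space (PrimeSpectrum R) := by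
  obtain ⟨m, hm, hmu⟩ := hloc
  obtain ⟨q₁, q₂, h₁, h₂, hne⟩ := htwo
  refine ⟨fun p => ?_, fun hT => ?_⟩
  · by_cases hp : p.asIdeal.IsMaximal
    · exact Or.inl ((PrimeSpectrum.isClosed_singleton_iff_isMaximal p).2 hp)
    right
    have hpm := hmin _ p.2 hp
    have hopen : IsOpen ({p} : Set (PrimeSpectrum R)) := by
      have : ({p} : Set (PrimeSpectrum R)) = (⋃ q ∈ {q | q ≠ p}, closure {q})ᶜ := by
        ext x
        simp only [Set.mem_singleton_iff, Set.mem_compl_iff, Set.mem_iUnion, not_exists,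
          Set.mem_ofPred_eq, ← PrimeSpectrum.le_iff_mem_closure]
        constructor
        · rintro rfl q hq hle
          exact hq (PrimeSpectrum.ext (hpm.2 _ q.2 hle))
        · intro h
          by_contra hx
          exact h x hx le_rfl
      rw [this, isOpen_compl_iff]
      exact (Set.toFinite _).isClosed_biUnion (fun _ _ => isClosed_closure)
    apply Set.Subset.antisymm (interior_maximal subset_closure hopen)
    intro x hx
    by_contra hxp
    have hle : p ≤ x := (PrimeSpectrum.le_iff_mem_closure p x).2 (interior_subset hx)
    have hxm : x.asIdeal.IsMaximal := by
      by_contra hxm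
      exact hxp (PrimeSpectrum.ext ((hmin _ x.2 hxm).2 _ p.2 hle)).symm
    have key : ∀ q, IsMinPrime q → q = p.asIdeal := by
      intro q hq
      obtain ⟨M, hM, hqM⟩ := Ideal.exists_le_maximal q hq.1.ne_top
      have hMx : M = x.asIdeal := (hmu M hM).trans (hmu _ hxm).symm
      have hqx : (⟨q, hq.1⟩ : PrimeSpectrum R) ≤ x := hqM.trans hMx.le
      have hs := (PrimeSpectrum.le_iff_specializes _ _).1 hqx
      have hmem := interior_subset (hs.mem_open isOpen_interior hx)
      exact (hq.2 _ p.2 ((PrimeSpectrum.le_iff_mem_closure p _).2 hmem)).symm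
    exact hne ((key _ h₁).trans (key _ h₂).symm)
  · have key : ∀ q, IsMinPrime q → q = m := fun q hq =>
      hmu q ((PrimeSpectrum.isClosed_singleton_iff_isMaximal ⟨q, hq.1⟩).1 isClosed_singleton)
    exact hne ((key _ h₁).trans (key _ h₂).symm)
end

section
/- Let L be a complete lattice that is an X-top lattice for a subset X of L not containing ⊤, with X carrying the X-top topology. Suppose x ∈ X is a least element of X (x ≤ y for all y ∈ X) and X ≠ {x}. Then {x} is not closed and x is not regular open (indeed the closure of {x} is all of X, so the interior of the closure of {x} is X ≠ {x}); consequently X is not T_{3/4}. In particular, if a commutative semiring R has a unique minimal prime that is not maximal, then its prime spectrum with the Zariski topology is not T_{3/4}. -/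
theorem dense_aux {Y : Type*} [TopologicalSpace Y] (x : Y) (hc : closure ({x} : Set Y) = Set.univ)
    (hne : (Set.univ : Set Y) ≠ {x}) :
    ¬ IsClosed ({x} : Set Y) ∧ closure ({x} : Set Y) = Set.univ ∧
      interior (closure ({x} : Set Y)) = Set.univ ∧
      ({x} : Set Y) ≠ interior (closure {x}) ∧
      ¬ (∀ p : Y, IsClosed ({p} : Set Y) ∨ ({p} : Set Y) = interior (closure {p})) := by
  have h1 : ¬ IsClosed ({x} : Set Y) := fun h => hne (by rw [← hc, h.closure_eq])
  have h3 : interior (closure ({x} : Set Y)) = Set.univ := by rw [hc, interior_univ]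
  have h4 : ({x} : Set Y) ≠ interior (closure {x}) := fun h => hne (by rw [h3] at h; exact h.symm)
  exact ⟨h1, hc, h3, h4, fun h => (h x).elim h1 h4⟩

theorem xtop_closure_aux {L : Type*} [CompleteLattice L] (X : Set L) (x : X)
    (hx : ∀ y : X, (x : L) ≤ (y : L)) :
    @closure X (xTopTopology X) {x} = Set.univ := by
  letI := xTopTopology X
  have key : ∀ U : Set X, IsOpen U → U.Nonempty → x ∈ U := by
    intro U hU
    induction hU with
    | basic s hs =>
      obtain ⟨a, rfl⟩ := hs
      rintro ⟨y, hy⟩ hxa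
      exact hy (le_trans (show a ≤ (x : L) from hxa) (hx y))
    | univ => intro _; trivial
    | inter s t _ _ ihs iht =>
      rintro ⟨y, hy⟩
      exact ⟨ihs ⟨y, hy.1⟩, iht ⟨y, hy.2⟩⟩
    | sUnion S _ ih =>
      rintro ⟨y, s, hs, hy⟩
      exact ⟨s, hs, ih s hs ⟨y, hy⟩⟩
  refine Set.eq_univ_of_forall fun y => ?_
  rw [mem_closure_iff]
  intro U hU hy
  exact ⟨x, key U hU ⟨y, hy⟩, rfl⟩

theorem least_element_not_t_three_quarters :
    (∀ (L : Type*) [CompleteLattice L] (X : Set L), ⊤ ∉ X → IsXTop X →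
      ∀ x : X, (∀ y : X, (x : L) ≤ (y : L)) → (Set.univ : Set X) ≠ {x} →
        ¬ @IsClosed X (xTopTopology X) {x} ∧
        @closure X (xTopTopology X) {x} = Set.univ ∧
        @interior X (xTopTopology X) (@closure X (xTopTopology X) {x}) = Set.univ ∧
        ({x} : Set X) ≠ @interior X (xTopTopology X) (@closure X (xTopTopology X) {x}) ∧
        ¬ (∀ p : X, @IsClosed X (xTopTopology X) {p} ∨
            ({p} : Set X) = @interior X (xTopTopology X) (@closure X (xTopTopology X) {p}))) ∧
    (∀ (R : Type*) [CommSemiring R],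
      (∃ q : Ideal R, IsMinPrime q ∧ ¬ q.IsMaximal ∧ ∀ q' : Ideal R, IsMinPrime q' → q' = q) →
      ¬ (∀ p : PrimeSpectrum R, IsClosed ({p} : Set (PrimeSpectrum R)) ∨
          ({p} : Set (PrimeSpectrum R)) = interior (closure {p}))) := by
  refine ⟨?_, ?_⟩
  · intro L _ X _ _ x hx hne
    letI := xTopTopology X
    exact dense_aux x (xtop_closure_aux X x hx) hne
  · rintro R _ ⟨q, hq, hmax, huniq⟩
    have hle : ∀ p : Ideal R, p.IsPrime → q ≤ p := by
      intro p hp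
      obtain ⟨m, hm, hmp⟩ := Ideal.exists_minimalPrimes_le (I := ⊥) (J := p) bot_le
      have : m = q := huniq m ⟨hm.1.1, fun r hr hrm => le_antisymm hrm (hm.2 ⟨hr, bot_le⟩ hrm)⟩
      exact this ▸ hmp
    refine (dense_aux (⟨q, hq.1⟩ : PrimeSpectrum R) ?_ ?_).2.2.2.2
    · rw [PrimeSpectrum.closure_singleton]
      refine Set.eq_univ_of_forall fun y => ?_
      exact hle y.asIdeal y.isPrime
    · intro h
      obtain ⟨M, hM, hqM⟩ := Ideal.exists_le_maximal q hq.1.ne_top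
      have : (⟨M, hM.isPrime⟩ : PrimeSpectrum R) ∈ (Set.univ : Set _) := trivial
      rw [h] at this
      have h2 : M = q := congrArg PrimeSpectrum.asIdeal this
      exact hmax (h2 ▸ hM)
end
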